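/- arXiv:1710.00761 — 2 statements merged into one kernel-verified Lean document; each statement's English description precedes it below -/
import Mathlib

section
/- If M₁ and M₂ are distinct perfect matchings of G lying in the same connected component of the resonance graph R(G;F), then there exists an index i ∈ F such that M₁ and M₂ lie in different connected components of the graph obtained from R(G;F) by deleting all edges of E_i. -/
open SimpleGraph

variable {V : Type*} {I : Type*}

/-- `M` is (the edge set of) a perfect matching of the graph `G`: a set of edges of `G`
such that every vertex of `G` is incident with exactly one edge of `M`. -/
def IsPM (G : SimpleGraph V) (M : Set (Sym2 V)) : Prop :=
  M ⊆ G.edgeSet ∧ ∀ v : V, ∃! e, e ∈ M ∧ v ∈ e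

/-- `C` is the edge set of a connected 2-regular subgraph of `G`, i.e. a cycle of `G`. -/
def IsCycleSet (G : SimpleGraph V) (C : Set (Sym2 V)) : Prop :=
  C ⊆ G.edgeSet ∧ C.Nonempty ∧
    (∀ v ∈ (fromEdgeSet C).support, ((fromEdgeSet C).neighborSet v).ncard = 2) ∧
    ∀ v ∈ (fromEdgeSet C).support, ∀ w ∈ (fromEdgeSet C).support,
      (fromEdgeSet C).Reachable v w

/-- `C` is an even cycle of `G`. -/
def IsEvenCycleSet (G : SimpleGraph V) (C : Set (Sym2 V)) : Prop :=
  IsCycleSet G C ∧ Even C.ncard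

/-- The family `E : I → Set (Sym2 V)` is a face system on `G`: each `E i` is a set of
edges of `G`, every edge of `G` belongs to `E i` for exactly two indices `i`, and the
graph on `I` in which two distinct indices are adjacent iff their edge sets share an
edge is connected. -/
def IsFaceSystem (G : SimpleGraph V) (E : I → Set (Sym2 V)) : Prop :=
  (∀ i, E i ⊆ G.edgeSet) ∧
  (∀ e ∈ G.edgeSet, {i : I | e ∈ E i}.ncard = 2) ∧
  (SimpleGraph.fromRel fun i j : I => (E i ∩ E j).Nonempty).Connected

/-- The resonance graph `R(G;F)`: its vertices are the perfect matchings of `G`, and two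
perfect matchings are adjacent iff their symmetric difference is `E i` for some `i ∈ F`. -/
def resGraph (G : SimpleGraph V) (E : I → Set (Sym2 V)) (F : Set I) :
    SimpleGraph {M : Set (Sym2 V) // IsPM G M} :=
  SimpleGraph.fromRel fun M₁ M₂ => ∃ i ∈ F, symmDiff M₁.1 M₂.1 = E i

/-- The graph obtained from the resonance graph `R(G;F)` by deleting all edges of
`E_i`, i.e. all edges `{M₁, M₂}` with `M₁ Δ M₂ = E i`. -/
def resGraphDel (G : SimpleGraph V) (E : I → Set (Sym2 V)) (F : Set I) (i : I) :
    SimpleGraph {M : Set (Sym2 V) // IsPM G M} :=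
  SimpleGraph.fromRel fun M₁ M₂ =>
    (∃ j ∈ F, symmDiff M₁.1 M₂.1 = E j) ∧ symmDiff M₁.1 M₂.1 ≠ E i

theorem aux_walk [Fintype V] [Fintype I] (G : SimpleGraph V)
    (E : I → Set (Sym2 V)) (hface : IsFaceSystem G E) (F : Set I)
    (R : SimpleGraph {M : Set (Sym2 V) // IsPM G M})
    (hR : ∀ A B, R.Adj A B → ∃ j ∈ F, symmDiff A.1 B.1 = E j)
    (A B : {M : Set (Sym2 V) // IsPM G M}) (h : R.Reachable A B) :
    ∃ S : Set I, S ⊆ F ∧ ∀ e a b, a ≠ b → e ∈ E a → e ∈ E b →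
      (e ∈ symmDiff A.1 B.1 ↔ ¬ (a ∈ S ↔ b ∈ S)) := by
  obtain ⟨w⟩ := h
  induction w with
  | nil => exact ⟨∅, by simp, by simp⟩
  | @cons u v w hadj p ih =>
    obtain ⟨S, hS, hP⟩ := ih
    obtain ⟨j, hj, hjE⟩ := hR _ _ hadj
    refine ⟨symmDiff S {j}, ?_, ?_⟩
    · intro x hx
      rcases hx with ⟨hx, _⟩ | ⟨hx, _⟩
      · exact hS hx
      · rw [Set.mem_singleton_iff.1 hx]; exact hj
    · intro e a b hab ha hb
      have h1 := hP e a b hab ha hb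
      have h2 : e ∈ E j ↔ (j = a ∨ j = b) := by
        constructor
        · intro hej
          obtain ⟨x, y, _, hxy⟩ := Set.ncard_eq_two.1 (hface.2.1 e (hface.1 a ha))
          have ka : a ∈ ({x, y} : Set I) := hxy ▸ ha
          have kb : b ∈ ({x, y} : Set I) := hxy ▸ hb
          have kj : j ∈ ({x, y} : Set I) := hxy ▸ hej
          simp only [Set.mem_insert_iff, Set.mem_singleton_iff] at ka kb kj
          grind
        · rintro (rfl | rfl) <;> assumption
      rw [← hjE] at h2
      simp only [Set.mem_symmDiff, Set.mem_singleton_iff] at h1 h2 ⊢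
      grind

/-- If `M₁` and `M₂` are distinct perfect matchings of `G` lying in
the same connected component of `R(G;F)`, then there exists `i ∈ F` such that `M₁` and
`M₂` lie in different connected components of the graph obtained from `R(G;F)` by
deleting all edges of `E_i`. -/
theorem statement13 [Fintype V] [Fintype I] (G : SimpleGraph V)
    (E : I → Set (Sym2 V)) (hface : IsFaceSystem G E)
    (F : Set I) (hF : F ≠ Set.univ) (hFcyc : ∀ i ∈ F, IsEvenCycleSet G (E i))
    (M₁ M₂ : {M : Set (Sym2 V) // IsPM G M}) (hne : M₁ ≠ M₂)
    (hreach : (resGraph G E F).Reachable M₁ M₂) :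
    ∃ i ∈ F, ¬ (resGraphDel G E F i).Reachable M₁ M₂ := by
  obtain ⟨S, hS, hP⟩ := aux_walk G E hface F (resGraph G E F) (by
    intro A B h
    rcases h with ⟨_, h | ⟨j, hj, h⟩⟩
    · exact h
    · exact ⟨j, hj, by rw [symmDiff_comm]; exact h⟩) M₁ M₂ hreach
  have hSne : S.Nonempty := by
    by_contra hS0
    rw [Set.not_nonempty_iff_eq_empty] at hS0
    subst hS0
    apply hne
    apply Subtype.ext
    ext e
    by_cases he : e ∈ G.edgeSet
    · obtain ⟨x, y, hne', hxy⟩ := Set.ncard_eq_two.1 (hface.2.1 e he)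
      have hx : x ∈ {i | e ∈ E i} := by rw [hxy]; simp
      have hy : y ∈ {i | e ∈ E i} := by rw [hxy]; simp
      have := hP e x y hne' hx hy
      simp only [Set.mem_symmDiff, Set.mem_empty_iff_false] at this
      tauto
    · exact ⟨fun h => absurd (M₁.2.1 h) he, fun h => absurd (M₂.2.1 h) he⟩
  obtain ⟨i, hi⟩ := hSne
  refine ⟨i, hS hi, fun hdel => ?_⟩
  obtain ⟨T, hT, hQ⟩ := aux_walk G E hface (F \ {i}) (resGraphDel G E F i) (by
    intro A B h
    rcases h with ⟨_, ⟨⟨j, hj, h⟩, hn⟩ | ⟨⟨j, hj, h⟩, hn⟩⟩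
    · exact ⟨j, ⟨hj, by rintro rfl; exact hn h⟩, h⟩
    · exact ⟨j, ⟨hj, by rintro rfl; exact hn h⟩, by rw [symmDiff_comm]; exact h⟩) M₁ M₂ hdel
  obtain ⟨k, hk⟩ := (Set.ne_univ_iff_exists_notMem F).1 hF
  have key : ∀ x y, (SimpleGraph.fromRel fun i j : I => (E i ∩ E j).Nonempty).Reachable x y →
      ((x ∈ S ↔ x ∈ T) ↔ (y ∈ S ↔ y ∈ T)) := by
    rintro x y ⟨w⟩
    induction w with
    | nil => rfl
    | @cons u v w hadj p ih =>
      rw [← ih]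
      obtain ⟨huv, h⟩ := hadj
      have : ∃ e, e ∈ E u ∧ e ∈ E v := by
        rcases h with ⟨e, h1, h2⟩ | ⟨e, h1, h2⟩
        · exact ⟨e, h1, h2⟩
        · exact ⟨e, h2, h1⟩
      obtain ⟨e, h1, h2⟩ := this
      have a1 := hP e u v huv h1 h2
      have a2 := hQ e u v huv h1 h2
      grind
  have h1 := (key k i (hface.2.2.preconnected k i)).1
    ⟨fun h => absurd (hS h) hk, fun h => absurd (hT h).1 hk⟩
  exact (hT (h1.1 hi)).2 rfl
end

section
/- Let M₁ and M₂ be perfect matchings of G lying in the same connected component of the resonance graph R(G;F), and let i ∈ F. Suppose there exists a path in R(G;F) from M₁ to M₂ that contains an odd number of edges of E_i and, for every j ∈ F with j ≠ i, an even number of edges of E_j. Then M₁ Δ M₂ = E(i); in particular, M₁ and M₂ are adjacent in R(G;F). -/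
open SimpleGraph

variable {V : Type*} {I : Type*}

/-- Let `M₁` and `M₂` be perfect matchings of `G` lying in the same
connected component of `R(G;F)` and let `i ∈ F`.  Suppose there is a path
`X 0, X 1, …, X t` in `R(G;F)` from `M₁` to `M₂` (distinct vertices, consecutive ones
adjacent) containing an odd number of edges of `E_i` and, for every `j ∈ F` with
`j ≠ i`, an even number of edges of `E_j`.  Then `M₁ Δ M₂ = E i`; in particular `M₁`
and `M₂` are adjacent in `R(G;F)`. -/
theorem statement14 [Fintype V] [Fintype I] (G : SimpleGraph V)
    (E : I → Set (Sym2 V)) (hface : IsFaceSystem G E)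
    (F : Set I) (hF : F ≠ Set.univ) (hFcyc : ∀ i ∈ F, IsEvenCycleSet G (E i))
    (M₁ M₂ : {M : Set (Sym2 V) // IsPM G M})
    (hreach : (resGraph G E F).Reachable M₁ M₂)
    (i : I) (hi : i ∈ F)
    (t : ℕ) (X : Fin (t + 1) → {M : Set (Sym2 V) // IsPM G M})
    (hX0 : X 0 = M₁) (hXt : X (Fin.last t) = M₂)
    (hXinj : Function.Injective X)
    (hXadj : ∀ n : Fin t, (resGraph G E F).Adj (X n.castSucc) (X n.succ))
    (hodd : Odd {n : Fin t | symmDiff (X n.castSucc).1 (X n.succ).1 = E i}.ncard)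
    (heven : ∀ j ∈ F, j ≠ i →
      Even {n : Fin t | symmDiff (X n.castSucc).1 (X n.succ).1 = E j}.ncard) :
    symmDiff M₁.1 M₂.1 = E i ∧ (resGraph G E F).Adj M₁ M₂ := by
  classical
  have hne : (E i).Nonempty := (hFcyc i hi).1.2.1
  have key : symmDiff M₁.1 M₂.1 = E i := by
    ext e
    let ind : Set (Sym2 V) → ZMod 2 := fun S => if e ∈ S then 1 else 0
    have hind : ∀ A B, ind (symmDiff A B) = ind B + ind A := by
      intro A B
      simp only [ind, Set.mem_symmDiff]
      by_cases h1 : e ∈ A <;> by_cases h2 : e ∈ B <;> simp [h1, h2] <;> decide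
    have hinj : ∀ A B, ind A = ind B → (e ∈ A ↔ e ∈ B) := by
      intro A B
      simp only [ind]
      by_cases h1 : e ∈ A <;> by_cases h2 : e ∈ B <;> simp [h1, h2]
    apply hinj
    let D : Fin t → Set (Sym2 V) := fun n => symmDiff (X n.castSucc).1 (X n.succ).1
    have hDF : ∀ n, ∃ j ∈ F, D n = E j := by
      intro n
      have h := hXadj n
      rw [resGraph, SimpleGraph.fromRel_adj] at h
      rcases h.2 with ⟨j, hj, h⟩ | ⟨j, hj, h⟩
      · exact ⟨j, hj, h⟩
      · exact ⟨j, hj, by rw [← h, symmDiff_comm]⟩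
    have h2 : ∀ x : ZMod 2, x + x = 0 := by decide
    have hsum1 : ∑ n, ind (D n) = ind (symmDiff M₁.1 M₂.1) := by
      have ha := Fin.sum_univ_succ (fun n => ind (X n).1)
      have hb := Fin.sum_univ_castSucc (fun n => ind (X n).1)
      simp only [D, hind, Finset.sum_add_distrib]
      rw [ha, hX0, hXt] at hb
      have h3 := h2 (ind M₁.1)
      have h4 := h2 (∑ n : Fin t, ind (X n.castSucc).1)
      linear_combination hb - h3 + h4
    have hcard : ∀ S, {n : Fin t | D n = S}.ncard = (Finset.univ.filter (fun n => D n = S)).card := by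
      intro S
      rw [← Set.ncard_coe_finset]
      simp
    have hsum2 : ∑ n, ind (D n) = ind (E i) := by
      rw [← Finset.sum_fiberwise_of_maps_to (s := Finset.univ) (t := Finset.univ.image D) (g := D)
        (fun n _ => Finset.mem_image_of_mem _ (Finset.mem_univ n))]
      rw [Finset.sum_eq_single (E i)]
      · rw [Finset.sum_congr rfl (g := fun _ => ind (E i))
          (fun n hn => by rw [(Finset.mem_filter.1 hn).2])]
        have h5 : ((Finset.univ.filter (fun n => D n = E i)).card : ZMod 2) = 1 := by
          rw [ZMod.natCast_eq_one_iff_odd, ← hcard]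
          exact hodd
        rw [Finset.sum_const, nsmul_eq_mul, h5, one_mul]
      · intro S hS hSi
        obtain ⟨n, -, rfl⟩ := Finset.mem_image.1 hS
        obtain ⟨j, hj, hDj⟩ := hDF n
        rw [Finset.sum_congr rfl (g := fun _ => ind (D n))
          (fun m hm => by rw [(Finset.mem_filter.1 hm).2])]
        have h5 : ((Finset.univ.filter (fun m => D m = D n)).card : ZMod 2) = 0 := by
          rw [ZMod.natCast_eq_zero_iff_even, ← hcard, hDj]
          exact heven j hj (fun h => hSi (by rw [hDj, h]))
        rw [Finset.sum_const, nsmul_eq_mul, h5, zero_mul]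
      · intro h
        exfalso
        apply h
        obtain ⟨n, hn⟩ := Set.nonempty_of_ncard_ne_zero hodd.pos.ne'
        exact Finset.mem_image.2 ⟨n, Finset.mem_univ _, hn⟩
    exact hsum1.symm.trans hsum2
  refine ⟨key, ?_⟩
  rw [resGraph, SimpleGraph.fromRel_adj]
  refine ⟨?_, Or.inl ⟨i, hi, key⟩⟩
  rintro rfl
  rw [symmDiff_self] at key
  rw [← key] at hne
  exact Set.not_nonempty_empty hne
end
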